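/- arXiv:1111.5448 — 4 statements merged into one kernel-verified Lean document; each statement's English description precedes it below -/
import Mathlib

section
/- Let A be a finitely complete pointed protomodular category, F a full replete reflective subcategory of A with reflector F : A → F, and (E, M) the induced reflective prefactorisation system. If F is protoadditive then the class E is stable under pullback along split epimorphisms. If, moreover, the reflector F is semi-left-exact, then the converse also holds: F is protoadditive if and only if E is stable under pullback along split epimorphisms. -/
open CategoryTheory CategoryTheory.Limits

universe v u v₂ u₂

namespace ProtoPaper

variable {C : Type u} [Category.{v} C]

section ZeroDefs

variable [HasZeroMorphisms C]

/-- `k` is a kernel of `f`. -/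
def IsKernelOf {K A B : C} (k : K ⟶ A) (f : A ⟶ B) : Prop :=
  ∃ w : k ≫ f = 0, Nonempty (IsLimit (KernelFork.ofι k w))

/-- `f` is a cokernel of `k`. -/
def IsCokernelOf {K A B : C} (f : A ⟶ B) (k : K ⟶ A) : Prop :=
  ∃ w : k ≫ f = 0, Nonempty (IsColimit (CokernelCofork.ofπ f w))

/-- A normal monomorphism: a kernel of some morphism. -/
def IsNormalMonoArrow {K A : C} (k : K ⟶ A) : Prop :=
  ∃ (B : C) (f : A ⟶ B), IsKernelOf k f

/-- A normal epimorphism: a cokernel of some morphism. -/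
def IsNormalEpiArrow {A B : C} (f : A ⟶ B) : Prop :=
  ∃ (K : C) (k : K ⟶ A), IsCokernelOf f k

/-- A split short exact sequence `0 → K → A ⇄ B → 0`. -/
structure IsSplitShortExact {K A B : C} (k : K ⟶ A) (f : A ⟶ B) (s : B ⟶ A) : Prop where
  isKernel : IsKernelOf k f
  split : s ≫ f = 𝟙 B

/-- A short exact sequence `0 → K → A → B → 0`. -/
structure IsShortExact {K A B : C} (k : K ⟶ A) (f : A ⟶ B) : Prop where
  isKernel : IsKernelOf k f
  isCokernel : IsCokernelOf f k

/-- A protosplit monomorphism: a kernel of a split epimorphism. -/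
def IsProtosplitMono {K A : C} (k : K ⟶ A) : Prop :=
  ∃ (B : C) (f : A ⟶ B) (s : B ⟶ A), IsSplitShortExact k f s

end ZeroDefs

/-- A pointed category is protomodular when the split short five lemma holds. -/
def IsProtomodular (C : Type u) [Category.{v} C] [HasZeroMorphisms C] : Prop :=
  ∀ ⦃K A B K' A' B' : C⦄ (k : K ⟶ A) (f : A ⟶ B) (s : B ⟶ A)
    (k' : K' ⟶ A') (f' : A' ⟶ B') (s' : B' ⟶ A')
    (κ : K ⟶ K') (α : A ⟶ A') (β : B ⟶ B'),
    IsSplitShortExact k f s → IsSplitShortExact k' f' s' →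
    k ≫ α = κ ≫ k' → f ≫ β = α ≫ f' → s ≫ α = β ≫ s' →
    IsIso κ → IsIso β → IsIso α

section Functors

variable {D : Type u₂} [Category.{v₂} D]

/-- A functor is protoadditive if it preserves split short exact sequences. -/
def IsProtoadditive [HasZeroMorphisms C] [HasZeroMorphisms D] (F : C ⥤ D) : Prop :=
  ∀ ⦃K A B : C⦄ (k : K ⟶ A) (f : A ⟶ B) (s : B ⟶ A),
    IsSplitShortExact k f s → IsSplitShortExact (F.map k) (F.map f) (F.map s)

/-- A functor preserves zero objects. -/
def PreservesZeroObjects (F : C ⥤ D) : Prop :=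
  ∀ X : C, IsZero X → IsZero (F.obj X)

/-- A functor preserves pullbacks along split epimorphisms. -/
def PreservesPullbacksAlongSplitEpis (F : C ⥤ D) : Prop :=
  ∀ ⦃P X Y Z : C⦄ (fst : P ⟶ X) (snd : P ⟶ Y) (f : X ⟶ Z) (g : Y ⟶ Z),
    IsSplitEpi f → IsPullback fst snd f g →
    IsPullback (F.map fst) (F.map snd) (F.map f) (F.map g)

end Functors

/-- A homological category: pointed, protomodular and regular (finitely complete with
pullback-stable (regular epi, mono) factorisations). -/
structure IsHomological (C : Type u) [Category.{v} C] [HasZeroObject C]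
    [HasZeroMorphisms C] : Prop where
  protomodular : IsProtomodular C
  hasFiniteLimits : HasFiniteLimits C
  regEpiMonoFac : ∀ ⦃X Y : C⦄ (f : X ⟶ Y),
    ∃ (I : C) (e : X ⟶ I) (m : I ⟶ Y), Nonempty (RegularEpi e) ∧ Mono m ∧ e ≫ m = f
  regEpiStable : ∀ ⦃P X Y Z : C⦄ (fst : P ⟶ X) (snd : P ⟶ Y) (f : X ⟶ Z) (g : Y ⟶ Z),
    IsPullback fst snd f g → Nonempty (RegularEpi f) → Nonempty (RegularEpi snd)

/-- An internal equivalence relation, given by a jointly monic pair which is internally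
reflexive, symmetric and transitive. -/
structure IsInternalEquivRel {R X : C} (p₁ p₂ : R ⟶ X) : Prop where
  jointlyMono : ∀ ⦃Z : C⦄ (a b : Z ⟶ R), a ≫ p₁ = b ≫ p₁ → a ≫ p₂ = b ≫ p₂ → a = b
  refl : ∃ d : X ⟶ R, d ≫ p₁ = 𝟙 X ∧ d ≫ p₂ = 𝟙 X
  symm : ∃ σ : R ⟶ R, σ ≫ p₁ = p₂ ∧ σ ≫ p₂ = p₁
  trans : ∀ ⦃P : C⦄ (q₁ q₂ : P ⟶ R), IsPullback q₁ q₂ p₂ p₁ →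
    ∃ t : P ⟶ R, t ≫ p₁ = q₁ ≫ p₁ ∧ t ≫ p₂ = q₂ ≫ p₂

/-- A semi-abelian category: homological, with binary coproducts, and exact
(every internal equivalence relation is a kernel pair). -/
structure IsSemiAbelian (C : Type u) [Category.{v} C] [HasZeroObject C]
    [HasZeroMorphisms C] : Prop where
  homological : IsHomological C
  hasBinaryCoproducts : HasBinaryCoproducts C
  equivRelEffective : ∀ ⦃R X : C⦄ (p₁ p₂ : R ⟶ X), IsInternalEquivRel p₁ p₂ →
    ∃ (Y : C) (f : X ⟶ Y), IsPullback p₁ p₂ f f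

/-- A full subcategory (given by a predicate on objects) is replete if it is closed
under isomorphisms. -/
def Replete (P : C → Prop) : Prop := ∀ ⦃X Y : C⦄, P X → (X ≅ Y) → P Y

/-- A reflection of `C` onto the full subcategory of objects satisfying `P`:
a reflector `F`, a unit `η`, landing in `P`, with the usual universal property. -/
structure Reflection (C : Type u) [Category.{v} C] (P : C → Prop) where
  F : C ⥤ C
  η : 𝟭 C ⟶ F
  mem : ∀ X : C, P (F.obj X)
  univ : ∀ ⦃X B : C⦄, P B → ∀ f : X ⟶ B, ∃! g : F.obj X ⟶ B, η.app X ≫ g = f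

variable {P : C → Prop}

/-- A (normal epi)-reflection: all units are normal epimorphisms. -/
def NormalEpiUnits [HasZeroMorphisms C] (R : Reflection C P) : Prop :=
  ∀ X : C, IsNormalEpiArrow (R.η.app X)

/-- `f` is a trivial extension with respect to the reflection `R`. -/
def IsTrivialExt (R : Reflection C P) {A B : C} (f : A ⟶ B) : Prop :=
  IsPullback (R.η.app A) f (R.F.map f) (R.η.app B)

/-- `p` is an effective descent morphism: the pullback functor between the slice
categories is monadic. -/
def IsEffectiveDescent [HasPullbacks C] {E B : C} (p : E ⟶ B) : Prop :=
  Nonempty (MonadicRightAdjoint (Over.pullback p))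

/-- A central extension with respect to the (absolute) Galois structure of a reflection:
some pullback along an effective descent morphism is a trivial extension. -/
def IsCentralExt [HasPullbacks C] (R : Reflection C P) {A B : C} (f : A ⟶ B) : Prop :=
  ∃ (E : C) (p : E ⟶ B), IsEffectiveDescent p ∧
    ∃ (Pb : C) (p1 : Pb ⟶ E) (p2 : Pb ⟶ A), IsPullback p1 p2 p f ∧ IsTrivialExt R p1

/-- A normal extension with respect to the (absolute) Galois structure of a reflection. -/
def IsNormalExt [HasPullbacks C] (R : Reflection C P) {A B : C} (f : A ⟶ B) : Prop :=
  IsEffectiveDescent f ∧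
    ∃ (Pb : C) (p1 p2 : Pb ⟶ A), IsPullback p1 p2 f f ∧ IsTrivialExt R p1

/-- A central extension with respect to the Galois structure of a reflection relative to
the class of normal epimorphisms. -/
def IsCentralExtN [HasZeroMorphisms C] (R : Reflection C P) {A B : C} (f : A ⟶ B) : Prop :=
  IsNormalEpiArrow f ∧ ∃ (E : C) (p : E ⟶ B), IsNormalEpiArrow p ∧
    ∃ (Pb : C) (p1 : Pb ⟶ E) (p2 : Pb ⟶ A), IsPullback p1 p2 p f ∧ IsTrivialExt R p1

/-- A normal extension with respect to the Galois structure of a reflection relative to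
the class of normal epimorphisms. -/
def IsNormalExtN [HasZeroMorphisms C] (R : Reflection C P) {A B : C} (f : A ⟶ B) : Prop :=
  IsNormalEpiArrow f ∧
    ∃ (Pb : C) (p1 p2 : Pb ⟶ A), IsPullback p1 p2 f f ∧ IsTrivialExt R p1

/-- The reflector is semi-left-exact: it preserves pullbacks of units along morphisms
with domain in the subcategory. -/
def SemiLeftExact (R : Reflection C P) : Prop :=
  ∀ ⦃A X Pb : C⦄ (x : X ⟶ R.F.obj A) (p1 : Pb ⟶ A) (p2 : Pb ⟶ X), P X →
    IsPullback p1 p2 (R.η.app A) x →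
    IsPullback (R.F.map p1) (R.F.map p2) (R.F.map (R.η.app A)) (R.F.map x)

/-- The reflector has stable units: it preserves pullbacks of units along arbitrary
morphisms. -/
def StableUnits (R : Reflection C P) : Prop :=
  ∀ ⦃A X Pb : C⦄ (x : X ⟶ R.F.obj A) (p1 : Pb ⟶ A) (p2 : Pb ⟶ X),
    IsPullback p1 p2 (R.η.app A) x →
    IsPullback (R.F.map p1) (R.F.map p2) (R.F.map (R.η.app A)) (R.F.map x)

/-- The reflection is admissible with respect to the class of normal epimorphisms:
the reflector preserves pullbacks of units along normal epimorphisms with domain in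
the subcategory. -/
def AdmissibleN [HasZeroMorphisms C] (R : Reflection C P) : Prop :=
  ∀ ⦃A X Pb : C⦄ (x : X ⟶ R.F.obj A) (p1 : Pb ⟶ A) (p2 : Pb ⟶ X), P X →
    IsNormalEpiArrow x →
    IsPullback p1 p2 (R.η.app A) x →
    IsPullback (R.F.map p1) (R.F.map p2) (R.F.map (R.η.app A)) (R.F.map x)

/-- The radical associated to a (normal epi)-reflection is idempotent. -/
def IdempotentRadical [HasZeroMorphisms C] (R : Reflection C P) : Prop :=
  ∀ ⦃A TA : C⦄ (t : TA ⟶ A), IsKernelOf t (R.η.app A) →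
    ∀ ⦃T2 : C⦄ (t2 : T2 ⟶ TA), IsKernelOf t2 (R.η.app TA) → IsIso t2

/-- Condition (N) for a (normal epi)-reflection: for any morphism `f` with kernel
`k : K ⟶ A`, and any kernel `t : TK ⟶ K` of the unit at `K`, the composite `t ≫ k`
is a normal monomorphism. -/
def ConditionN [HasZeroMorphisms C] (R : Reflection C P) : Prop :=
  ∀ ⦃A B : C⦄ (f : A ⟶ B) ⦃K : C⦄ (k : K ⟶ A), IsKernelOf k f →
    ∀ ⦃TK : C⦄ (t : TK ⟶ K), IsKernelOf t (R.η.app K) → IsNormalMonoArrow (t ≫ k)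

/-- A torsion theory on a pointed category, given by a pair of full replete
subcategories. -/
structure TorsionTheory (C : Type u) [Category.{v} C] [HasZeroMorphisms C]
    (T F : C → Prop) : Prop where
  repleteT : Replete T
  repleteF : Replete F
  hom_zero : ∀ ⦃X Y : C⦄ (f : X ⟶ Y), T X → F Y → f = 0
  exists_ses : ∀ A : C, ∃ (TA FA : C) (t : TA ⟶ A) (q : A ⟶ FA),
    T TA ∧ F FA ∧ IsShortExact t q

/-- Condition (N) for a torsion theory, formulated without reference to a chosen
reflector: for any morphism `f` with kernel `k : K ⟶ A` and any short exact sequence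
`0 → TK → K → FK → 0` with `TK` torsion and `FK` torsion-free, the composite
`TK → A` is a normal monomorphism. -/
def TTConditionN [HasZeroMorphisms C] (T F : C → Prop) : Prop :=
  ∀ ⦃A B K TK FK : C⦄ (f : A ⟶ B) (k : K ⟶ A) (t : TK ⟶ K) (q : K ⟶ FK),
    IsKernelOf k f → T TK → F FK → IsShortExact t q → IsNormalMonoArrow (t ≫ k)

/-- Condition (P) for a torsion theory: the torsion-free reflector is protoadditive
(formulated for every (normal epi)-reflection onto the torsion-free part). -/
def TTConditionP [HasZeroMorphisms C] (T F : C → Prop) : Prop :=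
  ∀ R : Reflection C F, NormalEpiUnits R → IsProtoadditive R.F

/-- Orthogonality `e ↓ m` of two morphisms. -/
def Orthogonal {A B X Y : C} (e : A ⟶ B) (m : X ⟶ Y) : Prop :=
  ∀ (a : A ⟶ X) (b : B ⟶ Y), e ≫ b = a ≫ m →
    ∃! d : B ⟶ X, e ≫ d = a ∧ d ≫ m = b

/-- The class of morphisms orthogonal on the right to all members of `E`. -/
def dnOrth (E : MorphismProperty C) : MorphismProperty C :=
  fun _ _ m => ∀ ⦃A B : C⦄ (e : A ⟶ B), E e → Orthogonal e m

/-- The class of morphisms orthogonal on the left to all members of `M`. -/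
def upOrth (M : MorphismProperty C) : MorphismProperty C :=
  fun _ _ e => ∀ ⦃X Y : C⦄ (m : X ⟶ Y), M m → Orthogonal e m

/-- A prefactorisation system. -/
structure IsPrefactorisationSystem (E M : MorphismProperty C) : Prop where
  E_eq : E = upOrth M
  M_eq : M = dnOrth E

/-- A factorisation system. -/
structure IsFactorisationSystem (E M : MorphismProperty C) : Prop where
  E_eq : E = upOrth M
  M_eq : M = dnOrth E
  fac : ∀ ⦃X Y : C⦄ (f : X ⟶ Y),
    ∃ (I : C) (e : X ⟶ I) (m : I ⟶ Y), E e ∧ M m ∧ e ≫ m = f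

/-- A pullback-stable class of morphisms. -/
def PullbackStable (E : MorphismProperty C) : Prop :=
  ∀ ⦃P X Y Z : C⦄ (fst : P ⟶ X) (snd : P ⟶ Y) (f : X ⟶ Z) (g : Y ⟶ Z),
    IsPullback fst snd f g → E f → E snd

/-- The class of morphisms inverted by the reflector. -/
def invertedByR (R : Reflection C P) : MorphismProperty C :=
  fun _ _ f => IsIso (R.F.map f)

/-- The class of morphisms all of whose pullbacks lie in `E` ("stably in `E`"). -/
def StablyIn (E : MorphismProperty C) : MorphismProperty C :=
  fun _ Y e => ∀ ⦃Pb W : C⦄ (fst : Pb ⟶ W) (snd : Pb ⟶ _) (g : W ⟶ Y),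
    IsPullback fst snd g e → E fst

/-- The class of morphisms locally in `M`: some pullback along an effective descent
morphism lies in `M`. -/
def locallyIn [HasPullbacks C] (M : MorphismProperty C) : MorphismProperty C :=
  fun _ B f => ∃ (E : C) (p : E ⟶ B), IsEffectiveDescent p ∧
    ∃ (Pb : C) (p1 : Pb ⟶ E) (p2 : Pb ⟶ _), IsPullback p1 p2 p f ∧ M p1

/-- The class `Ē` associated to a torsion theory: normal epimorphisms with torsion
kernel. -/
def Ebar [HasZeroMorphisms C] (T : C → Prop) : MorphismProperty C :=
  fun X _ e => IsNormalEpiArrow e ∧ ∃ (K : C) (k : K ⟶ X), IsKernelOf k e ∧ T K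

/-- The class `M̄` associated to a torsion theory: morphisms with torsion-free
kernel. -/
def Mbar [HasZeroMorphisms C] (F : C → Prop) : MorphismProperty C :=
  fun X _ m => ∃ (K : C) (k : K ⟶ X), IsKernelOf k m ∧ F K

/-- A Birkhoff subcategory: a (regular epi)-reflective subcategory such that the
naturality squares of the unit at regular epimorphisms are pushouts. -/
structure IsBirkhoff [HasZeroMorphisms C] (R : Reflection C P) : Prop where
  units_regEpi : ∀ X : C, Nonempty (RegularEpi (R.η.app X))
  pushout_units : ∀ ⦃A B : C⦄ (f : A ⟶ B), Nonempty (RegularEpi f) →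
    IsPushout f (R.η.app A) (R.η.app B) (R.F.map f)

section ArrowInstances

variable [HasZeroMorphisms C]

instance instZeroArrowHom (f g : Arrow C) : Zero (f ⟶ g) :=
  ⟨{ left := 0, right := 0, w := by simp }⟩

@[simp] lemma arrowHomZero_left (f g : Arrow C) : (0 : f ⟶ g).left = 0 := rfl

@[simp] lemma arrowHomZero_right (f g : Arrow C) : (0 : f ⟶ g).right = 0 := rfl

instance instArrowHasZeroMorphisms : HasZeroMorphisms (Arrow C) where
  comp_zero {X Y} f Z := by
    apply CommaMorphism.ext <;> simp
  zero_comp X {Y Z} f := by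
    apply CommaMorphism.ext <;> simp

end ArrowInstances


section Helpers

theorem isKernelOf_iff {C : Type u} [Category.{v} C] [HasZeroMorphisms C]
    {K A B : C} (k : K ⟶ A) (f : A ⟶ B) :
    IsKernelOf k f ↔ k ≫ f = 0 ∧ Mono k ∧
      ∀ ⦃W : C⦄ (h : W ⟶ A), h ≫ f = 0 → ∃ l : W ⟶ K, l ≫ k = h := by
  constructor
  · rintro ⟨w, ⟨hl⟩⟩
    refine ⟨w, ⟨fun a b hab => Fork.IsLimit.hom_ext hl hab⟩, fun W h hh => ?_⟩
    exact ⟨hl.lift (KernelFork.ofι h hh), hl.fac (KernelFork.ofι h hh) WalkingParallelPair.zero⟩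
  · rintro ⟨w, hm, hl⟩
    choose l hl using hl
    exact ⟨w, ⟨KernelFork.IsLimit.ofι k w (fun h hh => l h hh) (fun h hh => hl h hh)
      (fun h hh m hm' => by rw [← cancel_mono k, hm', hl])⟩⟩

variable {C : Type u} [Category.{v} C] {P : C → Prop} (R : Reflection C P)

theorem refl_hom_ext {X B : C} (hB : P B) {g h : R.F.obj X ⟶ B}
    (e : R.η.app X ≫ g = R.η.app X ≫ h) : g = h :=
  (R.univ hB (R.η.app X ≫ h)).unique e rfl

theorem refl_nat {X Y : C} (f : X ⟶ Y) : R.η.app X ≫ R.F.map f = f ≫ R.η.app Y :=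
  (R.η.naturality f).symm

theorem isIso_unit_of_retraction {X : C} (r : R.F.obj X ⟶ X)
    (hr : R.η.app X ≫ r = 𝟙 X) : IsIso (R.η.app X) := by
  refine ⟨r, hr, ?_⟩
  apply refl_hom_ext R (R.mem X)
  rw [← Category.assoc, hr]
  exact (Category.id_comp _).trans (Category.comp_id _).symm

theorem isIso_unit_of_mem {X : C} (hX : P X) : IsIso (R.η.app X) := by
  obtain ⟨r, hr, -⟩ := R.univ hX (𝟙 X)
  exact isIso_unit_of_retraction R r hr

theorem mem_of_retraction (hrepl : Replete P) {X : C} (r : R.F.obj X ⟶ X)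
    (hr : R.η.app X ≫ r = 𝟙 X) : P X := by
  have := isIso_unit_of_retraction R r hr
  exact hrepl (R.mem X) (asIso (R.η.app X)).symm

theorem map_unit_isIso (X : C) : IsIso (R.F.map (R.η.app X)) := by
  have h1 : IsIso (R.η.app (R.F.obj X)) := isIso_unit_of_mem R (R.mem X)
  have : R.F.map (R.η.app X) = R.η.app (R.F.obj X) := by
    apply refl_hom_ext R (R.mem _)
    exact refl_nat R (R.η.app X)
  rw [this]; exact h1

variable [HasZeroMorphisms C]

theorem dir1 [HasFiniteLimits C] (hpm : IsProtomodular C) (hF : IsProtoadditive R.F)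
    ⦃Pb X Y Z : C⦄ (fst : Pb ⟶ X) (snd : Pb ⟶ Y) (f : X ⟶ Z) (e : Y ⟶ Z)
    (hf : IsSplitEpi f) (hp : IsPullback fst snd f e) (he : invertedByR R e) :
    invertedByR R fst := by
  obtain ⟨⟨s, hs⟩⟩ := hf
  let k := kernel.ι f
  have hk : k ≫ f = 0 := kernel.condition f
  let k' : kernel f ⟶ Pb := hp.lift k 0 (by simp [hk])
  let s' : Y ⟶ Pb := hp.lift (e ≫ s) (𝟙 Y) (by simp [hs])
  have hk'1 : k' ≫ fst = k := hp.lift_fst _ _ _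
  have hk'2 : k' ≫ snd = 0 := hp.lift_snd _ _ _
  have hs'1 : s' ≫ fst = e ≫ s := hp.lift_fst _ _ _
  have hs'2 : s' ≫ snd = 𝟙 Y := hp.lift_snd _ _ _
  have h2 : IsSplitShortExact k f s :=
    ⟨(isKernelOf_iff _ _).2 ⟨hk, inferInstance, fun W h hh => ⟨kernel.lift f h hh, by simp [k]⟩⟩, hs⟩
  have h1 : IsSplitShortExact k' snd s' := by
    refine ⟨(isKernelOf_iff _ _).2 ⟨hk'2, ?_, fun W h hh => ?_⟩, hs'2⟩
    · have : Mono (k' ≫ fst) := by rw [hk'1]; infer_instance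
      exact mono_of_mono k' fst
    · refine ⟨kernel.lift f (h ≫ fst) ?_, ?_⟩
      · rw [Category.assoc, hp.w, ← Category.assoc, hh, zero_comp]
      · apply hp.hom_ext
        · rw [Category.assoc, hk'1]; simp [k]
        · rw [Category.assoc, hk'2, comp_zero]; exact hh.symm
  refine hpm _ _ _ _ _ _ (𝟙 _) (R.F.map fst) (R.F.map e) (hF _ _ _ h1) (hF _ _ _ h2)
    ?_ ?_ ?_ inferInstance he
  · rw [← R.F.map_comp, hk'1, Category.id_comp]
  · rw [← R.F.map_comp, ← R.F.map_comp, hp.w]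
  · rw [← R.F.map_comp, ← R.F.map_comp, hs'1]

theorem dir2 [HasZeroObject C] [HasFiniteLimits C] (hrepl : Replete P) (hsl : SemiLeftExact R)
    (hE : ∀ ⦃Pb X Y Z : C⦄ (fst : Pb ⟶ X) (snd : Pb ⟶ Y) (f : X ⟶ Z) (e : Y ⟶ Z),
          IsSplitEpi f → IsPullback fst snd f e →
          invertedByR R e → invertedByR R fst) : IsProtoadditive R.F := by
  intro K A B k f s hkfs
  obtain ⟨hker, hs⟩ := hkfs
  obtain ⟨hk, hkm, hkl⟩ := (isKernelOf_iff _ _).1 hker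
  open ZeroObject in
  have hP0 : P (0 : C) := mem_of_retraction R hrepl 0 ((isZero_zero C).eq_of_src _ _)
  have hηz : ∀ ⦃X Y : C⦄, R.F.map (0 : X ⟶ Y) = 0 := by
    open ZeroObject in
    have hz : IsZero (R.F.obj (0 : C)) := by
      have := isIso_unit_of_mem R hP0
      exact (isZero_zero C).of_iso (asIso (R.η.app (0 : C))).symm
    intro X Y
    have : (0 : X ⟶ Y) = (0 : X ⟶ (0 : C)) ≫ 0 := by simp
    rw [this, R.F.map_comp, hz.eq_of_tgt (R.F.map 0) 0, zero_comp]
  -- the kernel of `F f`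
  let i := kernel.ι (R.F.map f)
  have hi : i ≫ R.F.map f = 0 := kernel.condition _
  have hPK1 : P (kernel (R.F.map f)) := by
    obtain ⟨i', hi', -⟩ := R.univ (R.mem A) i
    have h0 : i' ≫ R.F.map f = 0 := by
      apply refl_hom_ext R (R.mem B)
      rw [← Category.assoc, hi', hi, comp_zero]
    refine mem_of_retraction R hrepl (kernel.lift _ i' h0) ?_
    rw [← cancel_mono i, Category.assoc, kernel.lift_ι, hi']; exact (Category.id_comp i).symm
  have hu0 : (k ≫ R.η.app A) ≫ R.F.map f = 0 := by
    rw [Category.assoc, refl_nat, ← Category.assoc, hk, zero_comp]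
  obtain ⟨u, hu⟩ : ∃ u : K ⟶ kernel (R.F.map f), u ≫ i = k ≫ R.η.app A :=
    ⟨kernel.lift _ _ hu0, kernel.lift_ι _ _ _⟩
  -- the two pullbacks of units
  obtain ⟨Q, q1, q2, hQ⟩ : ∃ (Q : C) (q1 : Q ⟶ A) (q2 : Q ⟶ kernel (R.F.map f)),
      IsPullback q1 q2 (R.η.app A) i :=
    ⟨_, _, _, IsPullback.of_hasPullback _ _⟩
  open ZeroObject in
  obtain ⟨T, t1, t2, hT⟩ : ∃ (T : C) (t1 : T ⟶ B) (t2 : T ⟶ (0 : C)),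
      IsPullback t1 t2 (R.η.app B) (0 : (0 : C) ⟶ R.F.obj B) :=
    ⟨_, _, _, IsPullback.of_hasPullback _ _⟩
  have hq2 : IsIso (R.F.map q2) := by
    have := map_unit_isIso R A
    exact (hsl _ _ _ hPK1 hQ).isIso_snd_of_isIso
  have ht2 : IsIso (R.F.map t2) := by
    have := map_unit_isIso R B
    exact (hsl _ _ _ hP0 hT).isIso_snd_of_isIso
  have ht1 : t1 ≫ R.η.app B = 0 := by rw [hT.w, comp_zero]
  open ZeroObject in
  have hz : invertedByR R (0 : (0 : C) ⟶ T) := by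
    have h1 : (0 : (0 : C) ⟶ T) ≫ t2 = 𝟙 _ := (isZero_zero C).eq_of_src _ _
    have h2 : IsIso (R.F.map (0 : (0 : C) ⟶ T) ≫ R.F.map t2) := by
      rw [← R.F.map_comp, h1]; infer_instance
    exact IsIso.of_isIso_comp_right _ (R.F.map t2)
  obtain ⟨g, hg⟩ : ∃ g : Q ⟶ T, g ≫ t1 = q1 ≫ f :=
    ⟨hT.lift (q1 ≫ f) 0 (by
      rw [comp_zero, Category.assoc, ← refl_nat, ← Category.assoc, hQ.w, Category.assoc, hi,
        comp_zero]), hT.lift_fst _ _ _⟩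
  obtain ⟨σ, hσ⟩ : ∃ σ : T ⟶ Q, σ ≫ q1 = t1 ≫ s :=
    ⟨hQ.lift (t1 ≫ s) 0 (by
      rw [zero_comp, Category.assoc, ← refl_nat, ← Category.assoc, ht1, zero_comp]),
      hQ.lift_fst _ _ _⟩
  have hextT : ∀ ⦃W : C⦄ (a b : W ⟶ T), a ≫ t1 = b ≫ t1 → a = b := fun W a b h =>
    hT.hom_ext h ((isZero_zero C).eq_of_tgt _ _)
  have hgs : IsSplitEpi g := by
    refine ⟨⟨σ, hextT _ _ ?_⟩⟩
    rw [Category.assoc, hg, ← Category.assoc, hσ, Category.assoc, hs, Category.comp_id,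
      Category.id_comp]
  obtain ⟨j, hj1, hj2⟩ : ∃ j : K ⟶ Q, j ≫ q1 = k ∧ j ≫ q2 = u :=
    ⟨hQ.lift k u hu.symm, hQ.lift_fst _ _ _, hQ.lift_snd _ _ _⟩
  have hextQ : ∀ ⦃W : C⦄ (a b : W ⟶ Q), a ≫ q1 = b ≫ q1 → a = b := fun W a b h =>
    hQ.hom_ext h (by
      rw [← cancel_mono i, Category.assoc, Category.assoc, ← hQ.w, ← Category.assoc, h,
        Category.assoc])
  open ZeroObject in
  have hpb : IsPullback j (0 : K ⟶ (0 : C)) g 0 := by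
    have hw : j ≫ g = (0 : K ⟶ (0 : C)) ≫ 0 := by
      apply hextT
      rw [Category.assoc, hg, ← Category.assoc, hj1, hk]; simp
    have hex : ∀ ⦃W : C⦄ (h : W ⟶ Q), h ≫ g = 0 → ∃ l : W ⟶ K, l ≫ k = h ≫ q1 := by
      intro W h hh
      apply hkl
      rw [Category.assoc, ← hg, ← Category.assoc, hh, zero_comp]
    choose l hl using hex
    refine ⟨⟨hw⟩, ⟨PullbackCone.IsLimit.mk hw
      (fun c => l c.fst (by rw [c.condition, comp_zero])) ?_ ?_ ?_⟩⟩
    · intro c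
      apply hextQ
      rw [Category.assoc, hj1, hl]
    · intro c
      exact (isZero_zero C).eq_of_tgt _ _
    · intro c m hm1 _
      rw [← cancel_mono k, hl, ← hm1, Category.assoc, hj1]
  have hj : IsIso (R.F.map j) := hE _ _ _ _ hgs hpb hz
  have hFu : IsIso (R.F.map u) := by
    rw [← hj2, R.F.map_comp]; infer_instance
  have hηK1 := isIso_unit_of_mem R hPK1
  have hfac : R.F.map u ≫ inv (R.η.app (kernel (R.F.map f))) ≫ i = R.F.map k := by
    apply refl_hom_ext R (R.mem A)
    rw [← Category.assoc, refl_nat, refl_nat, ← hu]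
    simp
  refine ⟨(isKernelOf_iff _ _).2 ⟨?_, ?_, fun W h hh => ?_⟩, ?_⟩
  · rw [← R.F.map_comp, hk, hηz]
  · rw [← hfac]; infer_instance
  · refine ⟨kernel.lift _ h hh ≫ R.η.app _ ≫ inv (R.F.map u), ?_⟩
    rw [← hfac]
    simp [i]
  · rw [← R.F.map_comp, hs, R.F.map_id]

end Helpers

/-- Theorem 2.10. Let `C` be a finitely complete pointed protomodular
category, `P` a full replete reflective subcategory with reflector `R`, and `E` the
class of morphisms inverted by the reflector (the left class of the induced reflective
(pre)factorisation system). If the reflector is protoadditive then `E` is stable under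
pullback along split epimorphisms; if moreover the reflector is semi-left-exact then
the two conditions are equivalent. -/
theorem statement7 {C : Type u} [Category.{v} C] [HasZeroObject C] [HasZeroMorphisms C]
    (hfl : HasFiniteLimits C) (hpm : IsProtomodular C)
    {P : C → Prop} (hrepl : Replete P) (R : Reflection C P) :
    (IsProtoadditive R.F →
      ∀ ⦃Pb X Y Z : C⦄ (fst : Pb ⟶ X) (snd : Pb ⟶ Y) (f : X ⟶ Z) (e : Y ⟶ Z),
        IsSplitEpi f → IsPullback fst snd f e →
        invertedByR R e → invertedByR R fst)
    ∧ (SemiLeftExact R →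
      (IsProtoadditive R.F ↔
        ∀ ⦃Pb X Y Z : C⦄ (fst : Pb ⟶ X) (snd : Pb ⟶ Y) (f : X ⟶ Z) (e : Y ⟶ Z),
          IsSplitEpi f → IsPullback fst snd f e →
          invertedByR R e → invertedByR R fst)) := by
  exact ⟨fun h => dir1 R hpm h, fun hsl => ⟨fun h => dir1 R hpm h, fun h => dir2 R hrepl hsl h⟩⟩

end ProtoPaper
end

section
/- Let F be a full replete subcategory of a finitely complete pointed category A in which normal epimorphisms are stable under pullback. The following conditions are equivalent: (1) F is a torsion-free subcategory of A (the torsion-free part of a torsion theory in A); (2) F is a (normal epi)-reflective subcategory of A and the induced radical is idempotent; (3) F is a (normal epi)-reflective subcategory of A and the reflector F : A → F has stable units; (4) F is a (normal epi)-reflective subcategory of A and the reflector F : A → F is semi-left-exact. -/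
open CategoryTheory CategoryTheory.Limits

universe v u v₂ u₂

namespace ProtoPaper

variable {C : Type u} [Category.{v} C]

variable {P : C → Prop}

section Helpers

variable [HasZeroMorphisms C]

lemma IsKernelOf.lift' {K A B : C} {k : K ⟶ A} {f : A ⟶ B} (h : IsKernelOf k f)
    {Z : C} (g : Z ⟶ A) (hg : g ≫ f = 0) : ∃ l : Z ⟶ K, l ≫ k = g := by
  obtain ⟨w, ⟨hl⟩⟩ := h
  exact ⟨hl.lift (KernelFork.ofι g hg), hl.fac (KernelFork.ofι g hg) WalkingParallelPair.zero⟩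

lemma IsKernelOf.hom_ext' {K A B : C} {k : K ⟶ A} {f : A ⟶ B} (h : IsKernelOf k f)
    {Z : C} (a b : Z ⟶ K) (hab : a ≫ k = b ≫ k) : a = b := by
  obtain ⟨w, ⟨hl⟩⟩ := h
  exact Fork.IsLimit.hom_ext hl hab

lemma IsCokernelOf.desc' {K A B : C} {k : K ⟶ A} {f : A ⟶ B} (h : IsCokernelOf f k)
    {Z : C} (g : A ⟶ Z) (hg : k ≫ g = 0) : ∃ l : B ⟶ Z, f ≫ l = g := by
  obtain ⟨w, ⟨hl⟩⟩ := h
  exact ⟨hl.desc (CokernelCofork.ofπ g hg),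
    hl.fac (CokernelCofork.ofπ g hg) WalkingParallelPair.one⟩

lemma IsCokernelOf.hom_ext' {K A B : C} {k : K ⟶ A} {f : A ⟶ B} (h : IsCokernelOf f k)
    {Z : C} (a b : B ⟶ Z) (hab : f ≫ a = f ≫ b) : a = b := by
  obtain ⟨w, ⟨hl⟩⟩ := h
  exact Cofork.IsColimit.hom_ext hl hab

lemma isIso_of_kernel_zero {K A B : C} {k : K ⟶ A} {f : A ⟶ B} (h : IsKernelOf k f)
    (hf : f = 0) : IsIso k := by
  obtain ⟨l, hl⟩ := h.lift' (𝟙 A) (by simp [hf])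
  exact ⟨l, h.hom_ext' _ _ (by simp [hl]), hl⟩

/-- A normal epimorphism has the cokernel property with respect to its kernel. -/
lemma normalEpi_desc {K A B : C} {k : K ⟶ A} {f : A ⟶ B} (hk : IsKernelOf k f)
    (hf : IsNormalEpiArrow f) : IsCokernelOf f k := by
  obtain ⟨L, l, hl⟩ := hf
  obtain ⟨m, hm⟩ := hk.lift' l hl.1
  have key : ∀ {Z : C} (g : A ⟶ Z), k ≫ g = 0 → ∃ d : B ⟶ Z, f ≫ d = g := fun g hg =>
    hl.desc' g (by rw [← hm, Category.assoc, hg, comp_zero])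
  refine ⟨hk.1, ⟨CokernelCofork.IsColimit.ofπ f hk.1 (fun g hg => (key g hg).choose)
    (fun g hg => (key g hg).choose_spec) (fun g hg m hm' => ?_)⟩⟩
  exact hl.hom_ext' _ _ (hm'.trans (key g hg).choose_spec.symm)

lemma exists_kernel [HasFiniteLimits C] {A B : C} (f : A ⟶ B) :
    ∃ (K : C) (k : K ⟶ A), IsKernelOf k f :=
  ⟨kernel f, kernel.ι f, kernel.condition f, ⟨kernelIsKernel f⟩⟩

end Helpers

lemma Reflection.hom_ext' (R : Reflection C P) {X B : C} (hB : P B) (a b : R.F.obj X ⟶ B)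
    (h : R.η.app X ≫ a = R.η.app X ≫ b) : a = b :=
  (R.univ hB (R.η.app X ≫ b)).unique h rfl

/-- A morphism which is orthogonal to the subcategory is inverted by the reflector. -/
lemma Reflection.isIso_map (R : Reflection C P) {A B : C} (f : A ⟶ B)
    (hex : ∀ ⦃Y : C⦄, P Y → ∀ g : A ⟶ Y, ∃ l : B ⟶ Y, f ≫ l = g)
    (huniq : ∀ ⦃Y : C⦄, P Y → ∀ a b : B ⟶ Y, f ≫ a = f ≫ b → a = b) :
    IsIso (R.F.map f) := by
  obtain ⟨g, hg⟩ := hex (R.mem A) (R.η.app A)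
  obtain ⟨g', hg', -⟩ := R.univ (R.mem A) g
  have nat : R.η.app A ≫ R.F.map f = f ≫ R.η.app B := (R.η.naturality f).symm
  refine ⟨g', R.hom_ext' (R.mem A) _ _ ?_, R.hom_ext' (R.mem B) _ _ ?_⟩
  · rw [← Category.assoc, nat, Category.assoc, hg', hg, Category.comp_id]
  · rw [← Category.assoc, hg', Category.comp_id]
    apply huniq (R.mem B)
    rw [← Category.assoc, hg, nat]

lemma Reflection.isIso_map_unit (R : Reflection C P) (A : C) : IsIso (R.F.map (R.η.app A)) :=
  R.isIso_map _ (fun _ hY g => (R.univ hY g).exists) (fun _ hY a b h => R.hom_ext' hY a b h)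

section Main

variable [HasZeroMorphisms C]

lemma exists_reflection_of_torsionTheory {T : C → Prop} (h : TorsionTheory C T P) :
    ∃ R : Reflection C P, NormalEpiUnits R ∧ IdempotentRadical R := by
  choose TA FA t q hT hF hs using h.exists_ses
  have ex : ∀ {X B : C}, P B → ∀ f : X ⟶ B, ∃ g : FA X ⟶ B, q X ≫ g = f := fun hB f =>
    (hs _).isCokernel.desc' f (h.hom_zero _ (hT _) hB)
  have un : ∀ {X B : C} (a b : FA X ⟶ B), q X ≫ a = q X ≫ b → a = b := fun a b hab =>
    (hs _).isCokernel.hom_ext' a b hab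
  choose m hm using fun (X Y : C) (f : X ⟶ Y) => ex (hF Y) (f ≫ q Y)
  let R : Reflection C P :=
    { F := { obj := FA
             map := fun {X Y} f => m X Y f
             map_id := fun X => un _ _ (by rw [hm]; simp)
             map_comp := fun {X Y Z} f g => un _ _ (by
              rw [hm, ← Category.assoc (q X), hm, Category.assoc, Category.assoc, hm]) }
      η := { app := q
             naturality := fun X Y f => (hm X Y f).symm }
      mem := hF
      univ := fun X B hB f => by
        obtain ⟨g, hg⟩ := ex hB f
        exact ⟨g, hg, fun g' hg' => un _ _ (hg'.trans hg.symm)⟩ }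
  refine ⟨R, fun X => ⟨TA X, t X, (hs X).isCokernel⟩, ?_⟩
  intro A K k hk T2 t2 ht2
  apply isIso_of_kernel_zero ht2
  have hk' : IsKernelOf k (q A) := hk
  obtain ⟨i, hi⟩ := hk'.lift' (t A) (hs A).isKernel.1
  obtain ⟨j, hj⟩ := (hs A).isKernel.lift' k hk'.1
  have hji : j ≫ i = 𝟙 K := hk'.hom_ext' _ _ (by rw [Category.assoc, hi, hj, Category.id_comp])
  change q K = 0
  rw [← Category.id_comp (q K), ← hji, Category.assoc,
    h.hom_zero (i ≫ q K) (hT A) (hF K), comp_zero]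

lemma unit_radical_zero [HasFiniteLimits C] {R : Reflection C P} (hi : IdempotentRadical R)
    {A K : C} {k : K ⟶ A} (hk : IsKernelOf k (R.η.app A)) : R.η.app K = 0 := by
  obtain ⟨L, l, hl⟩ := exists_kernel (R.η.app K)
  have := hi k hk l hl
  rw [← cancel_epi l, comp_zero]
  exact hl.1

lemma hom_radical_zero [HasFiniteLimits C] {R : Reflection C P} (hi : IdempotentRadical R)
    {A K : C} {k : K ⟶ A} (hk : IsKernelOf k (R.η.app A)) {Y : C} (hY : P Y) (f : K ⟶ Y) :
    f = 0 := by
  obtain ⟨g, hg, -⟩ := R.univ hY f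
  rw [← hg, unit_radical_zero hi hk]
  exact zero_comp

lemma torsionTheory_of_idempotent [HasFiniteLimits C] (hrepl : Replete P) (R : Reflection C P)
    (hn : NormalEpiUnits R) (hi : IdempotentRadical R) : ∃ T : C → Prop, TorsionTheory C T P := by
  refine ⟨fun X => ∀ ⦃Y : C⦄, P Y → ∀ f : X ⟶ Y, f = 0, ?_, hrepl, fun X Y f hX hY => hX hY f, ?_⟩
  · intro X X' hX e Y hY f
    rw [← cancel_epi e.hom, comp_zero]
    exact hX hY _
  · intro A
    obtain ⟨K, k, hk⟩ := exists_kernel (R.η.app A)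
    exact ⟨K, R.F.obj A, k, R.η.app A, fun Y hY f => hom_radical_zero hi hk hY f, R.mem A,
      hk, normalEpi_desc hk (hn A)⟩

lemma stableUnits_of_idempotent [HasFiniteLimits C]
    (hstab : ∀ ⦃Pb X Y Z : C⦄ (fst : Pb ⟶ X) (snd : Pb ⟶ Y) (f : X ⟶ Z) (g : Y ⟶ Z),
      IsPullback fst snd f g → IsNormalEpiArrow f → IsNormalEpiArrow snd)
    (R : Reflection C P)
    (hn : NormalEpiUnits R) (hi : IdempotentRadical R) : StableUnits R := by
  intro A X Pb x p1 p2 hp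
  obtain ⟨L, l, hl⟩ := exists_kernel p2
  -- the kernel of `p2` is the radical of `A`
  have hk : IsKernelOf (l ≫ p1) (R.η.app A) := by
    have w : (l ≫ p1) ≫ R.η.app A = 0 := by
      rw [Category.assoc, hp.w, ← Category.assoc, hl.1, zero_comp]
    have key : ∀ {Z : C} (g : Z ⟶ A), g ≫ R.η.app A = 0 → ∃ d : Z ⟶ L, d ≫ l ≫ p1 = g := by
      intro Z g hg
      obtain ⟨d, hd⟩ := hl.lift' (hp.lift g 0 (by rw [hg, zero_comp])) (by simp)
      exact ⟨d, by rw [← Category.assoc, hd]; simp⟩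
    refine ⟨w, ⟨KernelFork.IsLimit.ofι _ w (fun g hg => (key g hg).choose)
      (fun g hg => (key g hg).choose_spec) (fun g hg m hm => ?_)⟩⟩
    apply hl.hom_ext'
    apply hp.hom_ext
    · rw [Category.assoc, hm, Category.assoc, (key g hg).choose_spec]
    · rw [Category.assoc, Category.assoc, hl.1, comp_zero, comp_zero]
  have hc := normalEpi_desc hl (hstab _ _ _ _ hp (hn A))
  have := R.isIso_map_unit A
  have : IsIso (R.F.map p2) := R.isIso_map p2
    (fun Y hY g => hc.desc' g (hom_radical_zero hi hk hY _))
    (fun Y hY a b hab => hc.hom_ext' a b hab)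
  exact IsPullback.of_vert_isIso ⟨by rw [← R.F.map_comp, ← R.F.map_comp, hp.w]⟩

lemma idempotent_of_semiLeftExact [HasZeroObject C] (hrepl : Replete P) (R : Reflection C P)
    (hn : NormalEpiUnits R) (hs : SemiLeftExact R) : IdempotentRadical R := by
  intro A K k hk T2 t2 ht2
  apply isIso_of_kernel_zero ht2
  obtain ⟨Z, hZ⟩ : ∃ Z : C, IsZero Z := HasZeroObject.zero
  have hFZ : IsZero (R.F.obj Z) := by
    rw [IsZero.iff_id_eq_zero]
    exact R.hom_ext' (R.mem Z) _ _ (hZ.eq_of_src _ _)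
  have hPZ : P Z := hrepl (R.mem Z) (hFZ.iso hZ)
  have hp : IsPullback k (0 : K ⟶ Z) (R.η.app A) (0 : Z ⟶ R.F.obj A) := by
    refine ⟨⟨by rw [comp_zero]; exact hk.1⟩, ⟨PullbackCone.IsLimit.mk _
      (fun s => (hk.lift' s.fst (by rw [s.condition, comp_zero])).choose) (fun s =>
      (hk.lift' s.fst (by rw [s.condition, comp_zero])).choose_spec)
      (fun s => hZ.eq_of_tgt _ _) (fun s m h1 h2 => ?_)⟩⟩
    apply hk.hom_ext'
    rw [h1]
    exact (hk.lift' s.fst (by rw [s.condition, comp_zero])).choose_spec.symm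
  have hq := hs _ _ _ hPZ hp
  have := R.isIso_map_unit A
  have hiso : IsIso (R.F.map (0 : K ⟶ Z)) := hq.isIso_snd_of_isIso
  have hFK : IsZero (R.F.obj K) := hFZ.of_iso (asIso (R.F.map (0 : K ⟶ Z)))
  exact hFK.eq_of_tgt _ _

end Main

/-- Theorem 1.5. For a full replete subcategory `P` of a finitely
complete pointed category with pullback-stable normal epimorphisms, the following are
equivalent: (1) `P` is a torsion-free subcategory; (2) `P` is (normal epi)-reflective
with idempotent radical; (3) `P` is (normal epi)-reflective with a stable-units
reflector; (4) `P` is (normal epi)-reflective with a semi-left-exact reflector. -/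
theorem statement8 {C : Type u} [Category.{v} C] [HasZeroObject C] [HasZeroMorphisms C]
    (hfl : HasFiniteLimits C)
    (hstab : ∀ ⦃Pb X Y Z : C⦄ (fst : Pb ⟶ X) (snd : Pb ⟶ Y) (f : X ⟶ Z) (g : Y ⟶ Z),
      IsPullback fst snd f g → IsNormalEpiArrow f → IsNormalEpiArrow snd)
    {P : C → Prop} (hrepl : Replete P) :
    ((∃ Tp : C → Prop, TorsionTheory C Tp P) ↔
      (∃ R : Reflection C P, NormalEpiUnits R ∧ IdempotentRadical R))
    ∧ ((∃ R : Reflection C P, NormalEpiUnits R ∧ IdempotentRadical R) ↔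
      (∃ R : Reflection C P, NormalEpiUnits R ∧ StableUnits R))
    ∧ ((∃ R : Reflection C P, NormalEpiUnits R ∧ StableUnits R) ↔
      (∃ R : Reflection C P, NormalEpiUnits R ∧ SemiLeftExact R)) := by
  refine ⟨⟨?_, ?_⟩, ⟨?_, ?_⟩, ⟨?_, ?_⟩⟩
  · rintro ⟨T, h⟩
    exact exists_reflection_of_torsionTheory h
  · rintro ⟨R, hn, hi⟩
    exact torsionTheory_of_idempotent hrepl R hn hi
  · rintro ⟨R, hn, hi⟩
    exact ⟨R, hn, stableUnits_of_idempotent hstab R hn hi⟩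
  · rintro ⟨R, hn, hs⟩
    exact ⟨R, hn, idempotent_of_semiLeftExact hrepl R hn
      (fun _ _ _ x p1 p2 _ hp => hs x p1 p2 hp)⟩
  · rintro ⟨R, hn, hs⟩
    exact ⟨R, hn, fun _ _ _ x p1 p2 _ hp => hs x p1 p2 hp⟩
  · rintro ⟨R, hn, hs⟩
    exact ⟨R, hn, stableUnits_of_idempotent hstab R hn
      (idempotent_of_semiLeftExact hrepl R hn hs)⟩


end ProtoPaper
end

section
/- Let (T, F) be a torsion theory in a homological category A. Then e ↓ m for every e ∈ Ē and m ∈ M̄; that is, every normal epimorphism with torsion kernel is orthogonal to every morphism with torsion-free kernel. -/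
open CategoryTheory CategoryTheory.Limits

universe v u v₂ u₂

namespace ProtoPaper

variable {C : Type u} [Category.{v} C]

variable {P : C → Prop}

/-- Lemma 3.2. For any torsion theory `(Tp, Fp)` in a homological
category, every normal epimorphism with torsion kernel is orthogonal to every
morphism with torsion-free kernel: `e ↓ m` for all `e ∈ Ē` and `m ∈ M̄`. -/
theorem statement10 {C : Type u} [Category.{v} C] [HasZeroObject C] [HasZeroMorphisms C]
    (hC : IsHomological C) {Tp Fp : C → Prop} (tt : TorsionTheory C Tp Fp) :
    ∀ ⦃A B X Y : C⦄ (e : A ⟶ B) (m : X ⟶ Y),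
      Ebar Tp e → Mbar Fp m → Orthogonal e m := by
  intro A B X Y e m he hm a b hab
  obtain ⟨⟨K₀, k₀, w₀, ⟨hcol⟩⟩, K, k, ⟨wk, ⟨hk⟩⟩, hT⟩ := he
  obtain ⟨L, l, ⟨wl, ⟨hl⟩⟩, hF⟩ := hm
  -- the restriction of `a` to the torsion kernel of `e` vanishes
  have hka : k ≫ a = 0 := by
    have h0 : (k ≫ a) ≫ m = 0 := by
      rw [Category.assoc, ← hab, ← Category.assoc, wk, zero_comp]
    obtain ⟨u, hu⟩ := KernelFork.IsLimit.lift' hl (k ≫ a) h0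
    have hu' : u ≫ l = k ≫ a := hu
    rw [← hu', tt.hom_zero u hT hF, zero_comp]
  have hk₀a : k₀ ≫ a = 0 := by
    obtain ⟨u, hu⟩ := KernelFork.IsLimit.lift' hk k₀ w₀
    have hu' : u ≫ k = k₀ := hu
    rw [← hu', Category.assoc, hka, comp_zero]
  have hepi : ∀ ⦃Z : C⦄ (x y : B ⟶ Z), e ≫ x = e ≫ y → x = y := fun Z x y h =>
    Cofork.IsColimit.hom_ext hcol h
  obtain ⟨d, hd⟩ := CokernelCofork.IsColimit.desc' hcol a hk₀a
  have hd' : e ≫ d = a := hd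
  refine ⟨d, ⟨hd', hepi _ _ ?_⟩, ?_⟩
  · rw [← Category.assoc, hd', hab]
  · rintro d₂ ⟨h₂, -⟩
    exact hepi _ _ (h₂.trans hd'.symm)

end ProtoPaper
end

section
/- Let (T, F) be a torsion theory in a homological category A with torsion-free reflector F : A → F, and let E be the class of morphisms inverted by F. Then Ē ⊆ E': every normal epimorphism whose kernel lies in T is stably inverted by F, i.e. every pullback of such a morphism is inverted by F. -/
open CategoryTheory CategoryTheory.Limits

universe v u v₂ u₂

namespace ProtoPaper

variable {C : Type u} [Category.{v} C]

variable {P : C → Prop}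

section Helpers

variable [HasZeroMorphisms C]

lemma IsKernelOf.exists_lift {K A B : C} {k : K ⟶ A} {f : A ⟶ B} (h : IsKernelOf k f)
    {Z : C} (a : Z ⟶ A) (ha : a ≫ f = 0) : ∃ l : Z ⟶ K, l ≫ k = a := by
  obtain ⟨w, ⟨hl⟩⟩ := h
  exact ⟨hl.lift (KernelFork.ofι a ha), hl.fac _ WalkingParallelPair.zero⟩

lemma IsKernelOf.mono {K A B : C} {k : K ⟶ A} {f : A ⟶ B} (h : IsKernelOf k f) : Mono k := by
  obtain ⟨w, ⟨hl⟩⟩ := h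
  exact ⟨fun a b hab => Fork.IsLimit.hom_ext hl hab⟩

lemma isKernelOf_mk {K A B : C} {k : K ⟶ A} {f : A ⟶ B} [Mono k] (w : k ≫ f = 0)
    (h : ∀ {Z : C} (a : Z ⟶ A), a ≫ f = 0 → ∃ l : Z ⟶ K, l ≫ k = a) : IsKernelOf k f := by
  refine ⟨w, ⟨KernelFork.IsLimit.ofι k w (fun a ha => (h a ha).choose)
    (fun a ha => (h a ha).choose_spec) ?_⟩⟩
  intro Z a ha m hm
  rw [← cancel_mono k, hm, (h a ha).choose_spec]

/-- In a protomodular category, a morphism vanishing on the kernel of `f` identifies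
everything that `f` identifies. -/
lemma eq_of_kernel_zero [HasFiniteLimits C] (hC : IsProtomodular C) {K A B X : C} {k : K ⟶ A}
    {f : A ⟶ B} (hk : IsKernelOf k f) (g : A ⟶ X) (hg : k ≫ g = 0)
    {Z : C} (u v : Z ⟶ A) (huv : u ≫ f = v ≫ f) : u ≫ g = v ≫ g := by
  have hmono := hk.mono
  have hkf : k ≫ f = 0 := hk.1
  let p₁ := pullback.fst f f
  let p₂ := pullback.snd f f
  let i := equalizer.ι (p₁ ≫ g) (p₂ ≫ g)
  let d : A ⟶ pullback f f := pullback.lift (𝟙 A) (𝟙 A) rfl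
  have d1 : d ≫ p₁ = 𝟙 A := pullback.lift_fst _ _ _
  have d2 : d ≫ p₂ = 𝟙 A := pullback.lift_snd _ _ _
  let κ : K ⟶ pullback f f := pullback.lift 0 k (by simp [hkf])
  have κ1 : κ ≫ p₁ = 0 := pullback.lift_fst _ _ _
  have κ2 : κ ≫ p₂ = k := pullback.lift_snd _ _ _
  have κm : Mono κ := by
    have : Mono (κ ≫ p₂) := by rw [κ2]; exact hmono
    exact mono_of_mono κ p₂
  let d' : A ⟶ equalizer (p₁ ≫ g) (p₂ ≫ g) := equalizer.lift d (by
    rw [← Category.assoc, ← Category.assoc, d1, d2])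
  have hd' : d' ≫ i = d := equalizer.lift_ι _ _
  let κ' : K ⟶ equalizer (p₁ ≫ g) (p₂ ≫ g) := equalizer.lift κ (by
    rw [← Category.assoc, ← Category.assoc, κ1, κ2, hg, zero_comp])
  have hκ' : κ' ≫ i = κ := equalizer.lift_ι _ _
  have κm' : Mono κ' := by
    have : Mono (κ' ≫ i) := by rw [hκ']; exact κm
    exact mono_of_mono κ' i
  have hker : IsKernelOf κ p₁ := by
    refine isKernelOf_mk κ1 ?_
    intro Z a ha
    have h2 : (a ≫ p₂) ≫ f = 0 := by
      have hc : p₁ ≫ f = p₂ ≫ f := pullback.condition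
      rw [Category.assoc, ← hc, ← Category.assoc, ha, zero_comp]
    obtain ⟨l, hl⟩ := hk.exists_lift _ h2
    refine ⟨l, pullback.hom_ext ?_ ?_⟩
    · change (l ≫ κ) ≫ p₁ = a ≫ p₁
      rw [Category.assoc, κ1, ha, comp_zero]
    · change (l ≫ κ) ≫ p₂ = a ≫ p₂
      rw [Category.assoc, κ2, hl]
  have hker' : IsKernelOf κ' (i ≫ p₁) := by
    refine isKernelOf_mk (by rw [← Category.assoc, hκ', κ1]) ?_
    intro Z a ha
    obtain ⟨l, hl⟩ := hker.exists_lift (a ≫ i) (by rw [Category.assoc, ha])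
    refine ⟨l, ?_⟩
    rw [← cancel_mono i, Category.assoc, hκ', hl]
  have hi : IsIso i := hC κ' (i ≫ p₁) d' κ p₁ d (𝟙 K) i (𝟙 A)
    ⟨hker', by rw [← Category.assoc, hd', d1]⟩ ⟨hker, d1⟩
    (by rw [hκ', Category.id_comp]) (by rw [Category.comp_id])
    (by rw [hd', Category.id_comp]) inferInstance inferInstance
  have hp : p₁ ≫ g = p₂ ≫ g := by
    rw [← cancel_epi i]
    exact equalizer.condition _ _
  have h1 : pullback.lift u v huv ≫ p₁ = u := pullback.lift_fst _ _ _
  have h2 : pullback.lift u v huv ≫ p₂ = v := pullback.lift_snd _ _ _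
  calc u ≫ g = (pullback.lift u v huv ≫ p₁) ≫ g := by rw [h1]
    _ = (pullback.lift u v huv ≫ p₂) ≫ g := by rw [Category.assoc, hp, Category.assoc]
    _ = v ≫ g := by rw [h2]

end Helpers

/-- Lemma 3.4. For a torsion theory in a homological category with
torsion-free reflector `R`, every normal epimorphism whose kernel is torsion is stably
inverted by `R`: each of its pullbacks is inverted by the reflector. -/
theorem statement12 {C : Type u} [Category.{v} C] [HasZeroObject C] [HasZeroMorphisms C]
    (hC : IsHomological C) {Tp Fp : C → Prop} (tt : TorsionTheory C Tp Fp)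
    (R : Reflection C Fp)
    (hR : ∀ X : C, ∃ (K : C) (k : K ⟶ X), Tp K ∧ IsShortExact k (R.η.app X)) :
    ∀ ⦃A B : C⦄ (e : A ⟶ B), Ebar Tp e → StablyIn (invertedByR R) e := by
  intro A B e he Pb W fst snd g hpb
  obtain ⟨⟨L, l, wl, ⟨hl⟩⟩, K, k, hk, hT⟩ := he
  have := hC.hasFiniteLimits
  have hkmono := hk.mono
  have hke : k ≫ e = 0 := hk.1
  have hreg : Nonempty (RegularEpi e) := ⟨⟨L, l, 0, by rw [wl, zero_comp], hl⟩⟩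
  obtain ⟨hr⟩ := hC.regEpiStable snd fst e g hpb.flip hreg
  let k' : K ⟶ Pb := hpb.lift 0 k (by rw [hke, zero_comp])
  have k1 : k' ≫ fst = 0 := hpb.lift_fst _ _ _
  have k2 : k' ≫ snd = k := hpb.lift_snd _ _ _
  have km : Mono k' := by
    have : Mono (k' ≫ snd) := by rw [k2]; exact hkmono
    exact mono_of_mono k' snd
  have hker : IsKernelOf k' fst := by
    refine isKernelOf_mk k1 ?_
    intro Z a ha
    obtain ⟨m, hm⟩ := hk.exists_lift (a ≫ snd) (by
      rw [Category.assoc, ← hpb.w, ← Category.assoc, ha, zero_comp])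
    refine ⟨m, hpb.hom_ext ?_ ?_⟩
    · rw [Category.assoc, k1, ha, comp_zero]
    · rw [Category.assoc, k2, hm]
  have hz : k' ≫ R.η.app Pb = 0 := tt.hom_zero _ hT (R.mem Pb)
  have hcomm := eq_of_kernel_zero hC.protomodular hker (R.η.app Pb) hz hr.left hr.right hr.w
  obtain ⟨h, hh⟩ : ∃ h : W ⟶ R.F.obj Pb, fst ≫ h = R.η.app Pb :=
    ⟨hr.isColimit.desc (Cofork.ofπ _ hcomm), hr.isColimit.fac _ WalkingParallelPair.one⟩
  have hepi : Epi fst := ⟨fun a b hab => Cofork.IsColimit.hom_ext hr.isColimit hab⟩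
  obtain ⟨j, hj, -⟩ := R.univ (R.mem Pb) h
  have nat : fst ≫ R.η.app W = R.η.app Pb ≫ R.F.map fst := R.η.naturality fst
  change IsIso (R.F.map fst)
  refine ⟨j, ?_, ?_⟩
  · apply (R.univ (R.mem Pb) (R.η.app Pb)).unique
    · exact (Category.assoc _ _ _).symm.trans ((congrArg (· ≫ j) nat.symm).trans
        ((Category.assoc _ _ _).trans ((congrArg (fst ≫ ·) hj).trans hh)))
    · exact Category.comp_id _
  · apply (R.univ (R.mem W) (R.η.app W)).unique
    · exact (Category.assoc _ _ _).symm.trans ((congrArg (· ≫ R.F.map fst) hj).trans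
        ((cancel_epi fst).1 ((Category.assoc _ _ _).symm.trans
          ((congrArg (· ≫ R.F.map fst) hh).trans nat.symm))))
    · exact Category.comp_id _

end ProtoPaper
end
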